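/- Let z : [0, ∞) → ℝ be continuous. Then the Skorokhod reflection map f ↦ R_z f, viewed as a map from the space C([0, ∞), ℝ) of continuous real-valued functions on [0, ∞) to itself, is continuous with respect to the topology of uniform convergence on compact subsets of [0, ∞) (the compact-open topology). -/

import Mathlib

/-- The suprema of two functions over a nonempty set differ by at most `δ` in one direction if the
functions do so pointwise. -/
theorem sSup_image_le_sSup_image_add {α : Type*} {S : Set α} (hS : S.Nonempty) {u v : α → ℝ}
    {δ : ℝ} (hv : BddAbove (v '' S)) (h : ∀ s ∈ S, u s ≤ v s + δ) :
    sSup (u '' S) ≤ sSup (v '' S) + δ := by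
  refine csSup_le (hS.image u) ?_
  rintro _ ⟨s, hs, rfl⟩
  have := le_csSup hv (Set.mem_image_of_mem v hs)
  linarith [h s hs]

/-- Initial segments of `[0, ∞)` are compact. -/
theorem isCompact_Iic_of_Ici_zero (t : Set.Ici (0 : ℝ)) : IsCompact (Set.Iic t) := by
  rw [Subtype.isCompact_iff]
  convert isCompact_Icc (a := (0 : ℝ)) (b := t)
  ext x
  constructor
  · rintro ⟨s, hs, rfl⟩
    exact ⟨s.2, hs⟩
  · rintro ⟨h0, hx⟩
    exact ⟨⟨x, h0⟩, hx, rfl⟩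

/-- Continuity of the Skorokhod reflection map: let `z` be a continuous function on
`[0, ∞)` and let `Φ : C([0,∞), ℝ) → C([0,∞), ℝ)` be the map sending `f` to its
Skorokhod reflection off `z`, i.e. `(Φ f)(t) = f t + sup_{s ∈ [0,t]} max (z s − f s) 0`.
Then `Φ` is continuous with respect to the topology of uniform convergence on compact
subsets of `[0, ∞)` (the compact-open topology, which is the topology on `C(·, ℝ)`). -/
theorem skorokhod_map_continuous (z : C(Set.Ici (0 : ℝ), ℝ))
    (Φ : C(Set.Ici (0 : ℝ), ℝ) → C(Set.Ici (0 : ℝ), ℝ))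
    (hΦ : ∀ (f : C(Set.Ici (0 : ℝ), ℝ)) (t : Set.Ici (0 : ℝ)),
      Φ f t = f t + sSup ((fun s : Set.Ici (0 : ℝ) => max (z s - f s) 0) '' {s | s ≤ t})) :
    Continuous Φ := by
  rw [continuous_iff_continuousAt]
  intro f
  rw [ContinuousAt, ContinuousMap.tendsto_iff_forall_isCompact_tendstoUniformlyOn]
  intro K hK
  obtain ⟨T, hT⟩ := hK.bddAbove
  rw [Metric.tendstoUniformlyOn_iff]
  intro ε hε
  have hclose := Metric.tendstoUniformlyOn_iff.mp
    (ContinuousMap.tendsto_iff_forall_isCompact_tendstoUniformlyOn.mp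
      (Filter.tendsto_id (x := nhds f)) _ (isCompact_Iic_of_Ici_zero T)) (ε / 3) (by positivity)
  filter_upwards [hclose] with g hg t ht
  have hfg : ∀ s ≤ t, |f s - g s| < ε / 3 := fun s hs => hg s (hs.trans (hT ht))
  have hbdd : ∀ h : C(Set.Ici (0 : ℝ), ℝ),
      BddAbove ((fun s => max (z s - h s) 0) '' {s | s ≤ t}) := fun h =>
    (isCompact_Iic_of_Ici_zero t).bddAbove_image (by fun_prop)
  have hne : {s | s ≤ t}.Nonempty := ⟨t, le_refl t⟩
  have hle := sSup_image_le_sSup_image_add (u := fun s => max (z s - f s) 0)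
    (δ := ε / 3) hne (hbdd g) (by
      intro s hs
      have := abs_lt.mp (hfg s hs)
      refine max_le ?_ ?_
      · linarith [le_max_left (z s - g s) 0]
      · linarith [le_max_right (z s - g s) 0])
  have hge := sSup_image_le_sSup_image_add (u := fun s => max (z s - g s) 0)
    (δ := ε / 3) hne (hbdd f) (by
      intro s hs
      have := abs_lt.mp (hfg s hs)
      refine max_le ?_ ?_
      · linarith [le_max_left (z s - f s) 0]
      · linarith [le_max_right (z s - f s) 0])
  have ht' := abs_lt.mp (hfg t le_rfl)
  rw [Real.dist_eq, hΦ, hΦ, abs_lt]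
  constructor <;> linarith
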